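/- arXiv:1204.5703 — 2 statements merged into one kernel-verified Lean document; each statement's English description precedes it below -/
import Mathlib

section
/- Main theorem (threshold saturation): Let (f,g) be a scalar admissible system. If ε < ε* and w > K_{f,g}/ΔE(ε), then for every L ≥ 1 the only fixed point of the basic spatially-coupled system, i.e. the only x ∈ [0,1]^{𝓛} (extended by zero outside 𝓛) satisfying x_i = (1/w) Σ_{k=0}^{w−1} f( (1/w) Σ_{j=0}^{w−1} g(x_{i+j−k}); ε_{i−k} ) for all i ∈ 𝓛, is the all-zero vector x = 0. -/
open MeasureTheory Set Filter Topology

noncomputable section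

/-- A scalar admissible system `(f, g)` parameterized by `ε ∈ [0,1]`:
`f : [0,1]×[0,1] → [0,1]` is strictly increasing in both arguments for `x, ε ∈ (0,1]`,
`g : [0,1] → [0,1]` has `g'(x) > 0` for `x ∈ (0,1)`, `f(0;ε) = f(x;0) = g(0) = 0`,
and `f, g` have continuous second derivatives on `[0,1]` w.r.t. all arguments. -/
structure ScalarAdmissible (f : ℝ → ℝ → ℝ) (g : ℝ → ℝ) : Prop where
  f_mem : ∀ x ∈ Icc (0:ℝ) 1, ∀ ε ∈ Icc (0:ℝ) 1, f x ε ∈ Icc (0:ℝ) 1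
  g_mem : ∀ x ∈ Icc (0:ℝ) 1, g x ∈ Icc (0:ℝ) 1
  f_mono_x : ∀ ε ∈ Ioc (0:ℝ) 1, StrictMonoOn (fun x => f x ε) (Ioc (0:ℝ) 1)
  f_mono_eps : ∀ x ∈ Ioc (0:ℝ) 1, StrictMonoOn (fun ε => f x ε) (Ioc (0:ℝ) 1)
  g_deriv_pos : ∀ x ∈ Ioo (0:ℝ) 1, 0 < deriv g x
  f_zero_left : ∀ ε ∈ Icc (0:ℝ) 1, f 0 ε = 0
  f_zero_right : ∀ x ∈ Icc (0:ℝ) 1, f x 0 = 0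
  g_zero : g 0 = 0
  f_smooth : ContDiffOn ℝ 2 (fun p : ℝ × ℝ => f p.1 p.2) (Icc (0:ℝ) 1 ×ˢ Icc (0:ℝ) 1)
  g_smooth : ContDiffOn ℝ 2 g (Icc (0:ℝ) 1)

/-- The single-system potential `U(x;ε) = ∫₀ˣ (z − f(g(z);ε)) g'(z) dz`. -/
def singlePotential (f : ℝ → ℝ → ℝ) (g : ℝ → ℝ) (x ε : ℝ) : ℝ :=
  ∫ z in (0:ℝ)..x, (z - f (g z) ε) * deriv g z

/-- `u(ε) = sup { x̃ ∈ [0,1] : f(g(x);ε) < x for all x ∈ (0,x̃) }`,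
the minimum unstable fixed point. -/
def uFix (f : ℝ → ℝ → ℝ) (g : ℝ → ℝ) (ε : ℝ) : ℝ :=
  sSup {xt : ℝ | xt ∈ Icc (0:ℝ) 1 ∧ ∀ x : ℝ, 0 < x → x < xt → f (g x) ε < x}

/-- The energy gap `ΔE(ε) = min_{x ∈ [u(ε),1]} U(x;ε)`. -/
def energyGap (f : ℝ → ℝ → ℝ) (g : ℝ → ℝ) (ε : ℝ) : ℝ :=
  sInf ((fun x => singlePotential f g x ε) '' Icc (uFix f g ε) 1)

/-- The potential threshold
`ε* = sup { ε ∈ [0,1] : u(ε) > 0 and min_{x ∈ [u(ε),1]} U(x;ε) ≥ 0 }`. -/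
def potentialThreshold (f : ℝ → ℝ → ℝ) (g : ℝ → ℝ) : ℝ :=
  sSup {ε : ℝ | ε ∈ Icc (0:ℝ) 1 ∧ 0 < uFix f g ε ∧ 0 ≤ energyGap f g ε}

/-- `K_{f,g} = ‖g'‖_∞ + ‖g'‖_∞² ‖f'‖_∞ + ‖g''‖_∞`, with sup-norms over the unit interval
(and over `ε ∈ [0,1]` as well for `∂f/∂x`). -/
def Kfg (f : ℝ → ℝ → ℝ) (g : ℝ → ℝ) : ℝ :=
  sSup ((fun x => |deriv g x|) '' Icc (0:ℝ) 1) +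
    (sSup ((fun x => |deriv g x|) '' Icc (0:ℝ) 1)) ^ 2 *
      sSup ((fun p : ℝ × ℝ => |deriv (fun z => f z p.2) p.1|) '' (Icc (0:ℝ) 1 ×ˢ Icc (0:ℝ) 1)) +
    sSup ((fun x => |deriv (deriv g) x|) '' Icc (0:ℝ) 1)

/-- `ε_i = ε` for `i ∈ {−L,…,L}` and `ε_i = 0` otherwise. -/
def epsAt (ε : ℝ) (L : ℕ) (i : ℤ) : ℝ := if -(L:ℤ) ≤ i ∧ i ≤ (L:ℤ) then ε else 0

/-- The spatially-coupled update value
`(1/w) Σ_{k=0}^{w−1} f( (1/w) Σ_{j=0}^{w−1} g(x_{i+j−k}); ε_{i−k} )` at position `i`. -/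
def scPhi (f : ℝ → ℝ → ℝ) (g : ℝ → ℝ) (ε : ℝ) (L w : ℕ) (x : ℤ → ℝ) (i : ℤ) : ℝ :=
  (1 / (w:ℝ)) * ∑ k ∈ Finset.range w,
    f ((1 / (w:ℝ)) * ∑ j ∈ Finset.range w, g (x (i + (j:ℤ) - (k:ℤ))))
      (epsAt ε L (i - (k:ℤ)))

/-- One step of the basic spatially-coupled recursion on `𝓛 = {−L,…,L+w−1}`,
extended by zero outside `𝓛`. -/
def scUpdate (f : ℝ → ℝ → ℝ) (g : ℝ → ℝ) (ε : ℝ) (L w : ℕ) (x : ℤ → ℝ) : ℤ → ℝ :=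
  fun i => if -(L:ℤ) ≤ i ∧ i ≤ (L:ℤ) + (w:ℤ) - 1 then scPhi f g ε L w x i else 0

/-- Telescoping sums over integer intervals. -/
theorem sum_Ioc_sub_pred (φ : ℤ → ℝ) {a b : ℤ} (hab : a ≤ b) :
    ∑ i ∈ Finset.Ioc a b, (φ i - φ (i - 1)) = φ b - φ a := by
  induction b, hab using Int.leInduction with
  | base => simp
  | succ n hn ih =>
    rw [← Finset.insert_Ioc_right_eq_Ioc_add_one hn, Finset.sum_insert (by simp), ih,
      add_sub_cancel_right]
    ring

/-- For monotone `F`, the left-endpoint rectangle bounds the integral from below. -/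
theorem left_rectangle_le_integral {F : ℝ → ℝ} (hF : Monotone F) {a b : ℝ} (hab : a ≤ b) :
    F a * (b - a) ≤ ∫ t in a..b, F t := by
  have h := intervalIntegral.integral_mono_on hab
    (intervalIntegrable_const (μ := volume) (c := F a)) hF.intervalIntegrable fun t ht => hF ht.1
  simpa [mul_comm] using h

/-- A monotone subsolution `z` of the coupled system on `ℤ` that vanishes to the left and has a
constant value `h` to the right satisfies an energy bound of order `1 / w` at `h`. -/
theorem energy_le_of_monotone_subsolution {F G : ℝ → ℝ} (hF : Monotone F) (hG : Monotone G)
    (hF0 : ∀ t, 0 ≤ F t) (hF1 : ∀ t, F t ≤ 1) (hG0 : G 0 = 0) {w : ℕ} (hw : 1 ≤ w)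
    {z : ℤ → ℝ} (hz : Monotone z) {l r : ℤ} {h : ℝ} (hl : ∀ i < l, z i = 0)
    (hr : ∀ i, r ≤ i → z i = h)
    (hsub : ∀ i, z i ≤ (1 / (w : ℝ)) * ∑ k ∈ Finset.range w,
      F ((1 / (w : ℝ)) * ∑ j ∈ Finset.range w, G (z (i + (j : ℤ) - (k : ℤ))))) :
    h * G h - (∫ t in (0 : ℝ)..h, G t) - (∫ t in (0 : ℝ)..G h, F t) ≤ G h / w := by
  have hw0 : (0 : ℝ) < w := by exact_mod_cast hw
  set y : ℤ → ℝ := fun m => (1 / (w : ℝ)) * ∑ j ∈ Finset.range w, G (z (m + (j : ℤ))) with hy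
  set d : ℤ → ℝ := fun i => G (z i) - G (z (i - 1)) with hd
  have hd0 : ∀ i, 0 ≤ d i := fun i => sub_nonneg.2 (hG (hz (by omega)))
  have hdl : ∀ i < l, d i = 0 := fun i hi => by
    simp only [hd]; rw [hl i hi, hl (i - 1) (by omega), sub_self]
  have hsub' : ∀ i, z i ≤ (1 / (w : ℝ)) * ∑ k ∈ Finset.range w, F (y (i - (k : ℤ))) := by
    intro i
    refine (hsub i).trans_eq ?_
    simp only [hy]
    congr 1
    refine Finset.sum_congr rfl fun k _ => ?_
    congr 2
    refine Finset.sum_congr rfl fun j _ => ?_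
    congr 2
    ring
  have hymono : Monotone y := fun a b hab =>
    mul_le_mul_of_nonneg_left (Finset.sum_le_sum fun j _ => hG (hz (by omega))) (by positivity)
  have hydiff : ∀ m, y m - y (m - 1) = (1 / (w : ℝ)) * ∑ k ∈ Finset.range w, d (m + k) := by
    intro m
    simp only [hy, hd]
    rw [← mul_sub, ← Finset.sum_sub_distrib]
    congr 1
    refine Finset.sum_congr rfl fun j _ => ?_
    rw [show m - 1 + (j : ℤ) = m + j - 1 by ring]
  obtain ⟨A, hAl, hAr⟩ : ∃ A : ℤ, A + w ≤ l ∧ A ≤ r :=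
    ⟨min (l - w) r, by omega, by omega⟩
  have hzA : z A = 0 := hl A (by omega)
  have hzr : z r = h := hr r le_rfl
  have hh : 0 ≤ h := by rw [← hzA, ← hzr]; exact hz hAr
  have hz0 : ∀ i, 0 ≤ z i := fun i => by
    rw [← hl (min i A) (by omega)]; exact hz (by omega)
  have hzh : ∀ i, z i ≤ h := fun i => by
    rw [← hr (max i r) (by omega)]; exact hz (by omega)
  have hyA : y A = 0 := by
    simp only [hy]
    rw [Finset.sum_eq_zero, mul_zero]
    intro j hj
    rw [hl _ (by have := Finset.mem_range.1 hj; omega), hG0]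
  have hyr : y r = G h := by
    simp only [hy]
    rw [Finset.sum_congr rfl fun j _ => by rw [hr (r + (j : ℤ)) (by omega)]]
    rw [Finset.sum_const, Finset.card_range, nsmul_eq_mul]
    field_simp
  have hGh : 0 ≤ G h := hG0 ▸ hG hh
  have hystep : ∀ m, y m - y (m - 1) ≤ G h / w := by
    intro m
    rw [hydiff, one_div_mul_eq_div]
    refine div_le_div_of_nonneg_right ?_ hw0.le
    have := Finset.sum_range_sub (fun n : ℕ => G (z (m - 1 + n))) w
    calc ∑ k ∈ Finset.range w, d (m + k)
        = ∑ k ∈ Finset.range w, (G (z (m - 1 + (k + 1 : ℕ))) - G (z (m - 1 + k))) := by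
          refine Finset.sum_congr rfl fun k _ => ?_
          simp only [hd]
          congr 3 <;> push_cast <;> ring_nf
      _ = G (z (m - 1 + w)) - G (z (m - 1 + (0 : ℕ))) := this
      _ ≤ G h := by
          have h1 := hG (hzh (m - 1 + w))
          have h2 := hG (hz0 (m - 1 + (0 : ℕ)))
          rw [hG0] at h2
          linarith
  have hstart : h * G h - (∫ t in (0 : ℝ)..h, G t) ≤ ∑ i ∈ Finset.Ioc A r, z i * d i := by
    have htel := sum_Ioc_sub_pred (fun i => z i * G (z i) - ∫ t in (0 : ℝ)..z i, G t) hAr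
    simp only [hzA, hzr, zero_mul, intervalIntegral.integral_same, sub_zero] at htel
    rw [← htel]
    refine Finset.sum_le_sum fun i _ => ?_
    have hi : z (i - 1) ≤ z i := hz (by omega)
    have h1 := left_rectangle_le_integral hG hi
    rw [← intervalIntegral.integral_interval_sub_left (hG.intervalIntegrable (a := 0))
      hG.intervalIntegrable] at h1
    simp only [hd]
    nlinarith
  have hshift : ∀ k ∈ Finset.range w, ∑ i ∈ Finset.Ioc A r, F (y (i - (k : ℤ))) * d i
      ≤ ∑ m ∈ Finset.Ioc A r, F (y m) * d (m + k) := by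
    intro k hk
    have hk' := Finset.mem_range.1 hk
    calc ∑ i ∈ Finset.Ioc A r, F (y (i - (k : ℤ))) * d i
        = ∑ m ∈ Finset.Ioc (A - k) (r - k), F (y m) * d (m + k) := by
          refine Finset.sum_equiv (Equiv.subRight (k : ℤ)) (fun i => ?_) fun i _ => ?_
          · simp
          · simp
      _ ≤ ∑ m ∈ Finset.Ioc (A - k) r, F (y m) * d (m + k) :=
          Finset.sum_le_sum_of_subset_of_nonneg
            (Finset.Ioc_subset_Ioc_right (by omega)) fun m _ _ => mul_nonneg (hF0 _) (hd0 _)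
      _ = ∑ m ∈ Finset.Ioc A r, F (y m) * d (m + k) := by
          symm
          refine Finset.sum_subset (Finset.Ioc_subset_Ioc_left (by omega)) fun m hm hm' => ?_
          rw [Finset.mem_Ioc] at hm hm'
          rw [hdl _ (by omega), mul_zero]
  have hswap : ∑ i ∈ Finset.Ioc A r, z i * d i
      ≤ ∑ m ∈ Finset.Ioc A r, F (y m) * (y m - y (m - 1)) := by
    calc ∑ i ∈ Finset.Ioc A r, z i * d i
        ≤ ∑ i ∈ Finset.Ioc A r,
            ((1 / (w : ℝ)) * ∑ k ∈ Finset.range w, F (y (i - (k : ℤ)))) * d i :=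
          Finset.sum_le_sum fun i _ => mul_le_mul_of_nonneg_right (hsub' i) (hd0 i)
      _ = (1 / (w : ℝ)) * ∑ k ∈ Finset.range w,
            ∑ i ∈ Finset.Ioc A r, F (y (i - (k : ℤ))) * d i := by
          rw [Finset.sum_comm, Finset.mul_sum]
          exact Finset.sum_congr rfl fun i _ => by rw [mul_assoc, Finset.sum_mul]
      _ ≤ (1 / (w : ℝ)) * ∑ k ∈ Finset.range w,
            ∑ m ∈ Finset.Ioc A r, F (y m) * d (m + k) :=
          mul_le_mul_of_nonneg_left (Finset.sum_le_sum hshift) (by positivity)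
      _ = ∑ m ∈ Finset.Ioc A r, F (y m) * (y m - y (m - 1)) := by
          rw [Finset.sum_comm, Finset.mul_sum]
          refine Finset.sum_congr rfl fun m _ => ?_
          rw [hydiff, ← Finset.mul_sum]
          ring
  have hend : ∑ m ∈ Finset.Ioc A r, F (y m) * (y m - y (m - 1))
      ≤ (∫ t in (0 : ℝ)..G h, F t) + G h / w * (F (G h) - F 0) := by
    have htel := sum_Ioc_sub_pred
      (fun m => (∫ t in (0 : ℝ)..y m, F t) + G h / w * F (y m)) hAr
    simp only [hyA, hyr, intervalIntegral.integral_same] at htel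
    have : (∫ t in (0 : ℝ)..G h, F t) + G h / w * (F (G h) - F 0)
        = ∑ i ∈ Finset.Ioc A r, ((∫ t in (0 : ℝ)..y i, F t) + G h / w * F (y i)
          - ((∫ t in (0 : ℝ)..y (i - 1), F t) + G h / w * F (y (i - 1)))) := by
      rw [htel]; ring
    rw [this]
    refine Finset.sum_le_sum fun m _ => ?_
    have hm : y (m - 1) ≤ y m := hymono (by omega)
    have h1 := left_rectangle_le_integral hF hm
    rw [← intervalIntegral.integral_interval_sub_left (hF.intervalIntegrable (a := 0))
      hF.intervalIntegrable] at h1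
    have h2 := mul_le_mul_of_nonneg_right (hystep m) (sub_nonneg.2 (hF hm))
    nlinarith
  have hlast : G h / w * (F (G h) - F 0) ≤ G h / w :=
    mul_le_of_le_one_right (by positivity) (by linarith [hF1 (G h), hF0 0])
  linarith

/-- A finitely supported subsolution `x` of the coupled system is bounded by some `h` with
`h ≤ F (G h)` and energy of order `1 / w`, namely the limit of the running maximum of `x`. -/
theorem energy_le_of_subsolution {F G : ℝ → ℝ} (hF : Monotone F) (hG : Monotone G)
    (hF0 : ∀ t, 0 ≤ F t) (hF1 : ∀ t, F t ≤ 1) (hG0 : G 0 = 0) {w : ℕ} (hw : 1 ≤ w)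
    {x : ℤ → ℝ} (hx : ∀ i, x i ∈ Icc (0 : ℝ) 1) {l r : ℤ} (hl : ∀ i < l, x i = 0)
    (hr : ∀ i, r < i → x i = 0)
    (hsub : ∀ i, x i ≤ (1 / (w : ℝ)) * ∑ k ∈ Finset.range w,
      F ((1 / (w : ℝ)) * ∑ j ∈ Finset.range w, G (x (i + (j : ℤ) - (k : ℤ))))) :
    ∃ h ∈ Icc (0 : ℝ) 1, (∀ i, x i ≤ h) ∧ h ≤ F (G h) ∧
      h * G h - (∫ t in (0 : ℝ)..h, G t) - (∫ t in (0 : ℝ)..G h, F t) ≤ G h / w := by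
  have hw0 : (0 : ℝ) < w := by exact_mod_cast hw
  set z : ℤ → ℝ := fun i => ⨆ n : ℕ, x (i - n) with hzdef
  have hbdd : ∀ i, BddAbove (range fun n : ℕ => x (i - n)) := fun i =>
    ⟨1, by rintro _ ⟨n, rfl⟩; exact (hx _).2⟩
  have hxz : ∀ i j : ℤ, j ≤ i → x j ≤ z i := fun i j hij => by
    have := le_ciSup (hbdd i) (i - j).toNat
    rwa [show i - ((i - j).toNat : ℤ) = j by omega] at this
  have hzle : ∀ (i : ℤ) (c : ℝ), (∀ j ≤ i, x j ≤ c) → z i ≤ c := fun i c hc =>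
    ciSup_le fun n => hc _ (by omega)
  have hz : Monotone z := fun a b hab => hzle a _ fun j hj => hxz b j (hj.trans hab)
  have hz0 : ∀ i, 0 ≤ z i := fun i => (hx i).1.trans (hxz i i le_rfl)
  have hzl : ∀ i < l, z i = 0 := fun i hi =>
    le_antisymm (hzle i 0 fun j hj => (hl j (by omega)).le) (hz0 i)
  have hxr : ∀ i, x i ≤ z r := fun i => by
    rcases le_or_gt i r with h | h
    · exact hxz r i h
    · rw [hr i h]; exact hz0 r
  have hzr : ∀ i, r ≤ i → z i = z r := fun i hi =>
    le_antisymm (hzle i _ fun j _ => hxr j) (hz hi)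
  have hzsub : ∀ i, z i ≤ (1 / (w : ℝ)) * ∑ k ∈ Finset.range w,
      F ((1 / (w : ℝ)) * ∑ j ∈ Finset.range w, G (z (i + (j : ℤ) - (k : ℤ)))) := by
    refine fun i => hzle i _ fun j hj => (hsub j).trans ?_
    gcongr with k _ m _
    refine hF (mul_le_mul_of_nonneg_left (Finset.sum_le_sum fun m _ => hG ?_) (by positivity))
    exact hxz _ _ (by omega)
  refine ⟨z r, ⟨hz0 r, hzle r 1 fun j _ => (hx j).2⟩, hxr, ?_,
    energy_le_of_monotone_subsolution hF hG hF0 hF1 hG0 hw hz hzl hzr hzsub⟩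
  refine (hzsub r).trans ?_
  rw [one_div_mul_eq_div, div_le_iff₀ hw0]
  refine (Finset.sum_le_card_nsmul _ _ (F (G (z r))) fun k _ => hF ?_).trans_eq ?_
  · rw [one_div_mul_eq_div, div_le_iff₀ hw0]
    refine (Finset.sum_le_card_nsmul _ _ (G (z r)) fun j _ =>
      hG (hzle _ _ fun j _ => hxr j)).trans_eq ?_
    rw [Finset.card_range, nsmul_eq_mul, mul_comm]
  · rw [Finset.card_range, nsmul_eq_mul, mul_comm]

/-- The constant extension of `φ : [0,1] → ℝ` to the real line. -/
def unitExtend (φ : ℝ → ℝ) (t : ℝ) : ℝ := φ (max 0 (min t 1))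

theorem clamp_mem (t : ℝ) : max 0 (min t 1) ∈ Icc (0 : ℝ) 1 :=
  ⟨le_max_left _ _, max_le zero_le_one (min_le_right _ _)⟩

theorem unitExtend_of_mem (φ : ℝ → ℝ) {t : ℝ} (ht : t ∈ Icc (0 : ℝ) 1) :
    unitExtend φ t = φ t := by
  rw [unitExtend, min_eq_left ht.2, max_eq_right ht.1]

theorem monotone_unitExtend {φ : ℝ → ℝ} (h : MonotoneOn φ (Icc 0 1)) :
    Monotone (unitExtend φ) := fun _ _ hab =>
  h (clamp_mem _) (clamp_mem _) (max_le_max le_rfl (min_le_min hab le_rfl))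

theorem continuous_unitExtend {φ : ℝ → ℝ} (h : ContinuousOn φ (Icc 0 1)) :
    Continuous (unitExtend φ) :=
  h.comp_continuous (by fun_prop) clamp_mem

namespace ScalarAdmissible

variable {f : ℝ → ℝ → ℝ} {g : ℝ → ℝ} {ε ε' : ℝ}

theorem g_strictMonoOn (hsys : ScalarAdmissible f g) : StrictMonoOn g (Icc 0 1) :=
  strictMonoOn_of_deriv_pos (convex_Icc 0 1) hsys.g_smooth.continuousOn
    (by simpa only [interior_Icc] using hsys.g_deriv_pos)

theorem f_continuousOn (hsys : ScalarAdmissible f g) (hε : ε ∈ Icc (0 : ℝ) 1) :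
    ContinuousOn (fun t => f t ε) (Icc 0 1) :=
  hsys.f_smooth.continuousOn.comp (f := fun t : ℝ => (t, ε)) (by fun_prop) fun _ ht => ⟨ht, hε⟩

theorem f_monotoneOn (hsys : ScalarAdmissible f g) (hε : ε ∈ Icc (0 : ℝ) 1) :
    MonotoneOn (fun t => f t ε) (Icc 0 1) := by
  intro a ha b hb hab
  rcases hε.1.eq_or_lt with rfl | hpos
  · simp only [hsys.f_zero_right a ha, hsys.f_zero_right b hb, le_refl]
  rcases ha.1.eq_or_lt with rfl | ha0
  · simpa only [hsys.f_zero_left ε hε] using (hsys.f_mem b hb ε hε).1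
  · exact (hsys.f_mono_x ε ⟨hpos, hε.2⟩).monotoneOn ⟨ha0, ha.2⟩ ⟨ha0.trans_le hab, hb.2⟩ hab

theorem f_lt_of_lt (hsys : ScalarAdmissible f g) (hε : 0 ≤ ε) (hε' : ε' ≤ 1) (h : ε < ε')
    {t : ℝ} (ht : t ∈ Ioc (0 : ℝ) 1) : f t ε < f t ε' := by
  rcases hε.eq_or_lt with rfl | hpos
  · have h1 := hsys.f_mono_eps t ht ⟨half_pos h, by linarith⟩ ⟨h, hε'⟩ (half_lt_self h)
    have h2 := (hsys.f_mem t ⟨ht.1.le, ht.2⟩ (ε' / 2) ⟨by linarith, by linarith⟩).1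
    rw [hsys.f_zero_right t ⟨ht.1.le, ht.2⟩]
    exact h2.trans_lt h1
  · exact hsys.f_mono_eps t ht ⟨hpos, by linarith⟩ ⟨hpos.trans h, hε'⟩ h

theorem hasDerivAt_g (hsys : ScalarAdmissible f g) {t : ℝ} (ht : t ∈ Ioo (0 : ℝ) 1) :
    HasDerivAt g (deriv g t) t :=
  (differentiableAt_of_deriv_ne_zero (hsys.g_deriv_pos t ht).ne').hasDerivAt

theorem g_mem_Ioo (hsys : ScalarAdmissible f g) {t : ℝ} (ht : t ∈ Ioo (0 : ℝ) 1) :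
    g t ∈ Ioo (0 : ℝ) 1 := by
  have h0 := hsys.g_strictMonoOn ⟨le_rfl, zero_le_one⟩ ⟨ht.1.le, ht.2.le⟩ ht.1
  have h1 := hsys.g_strictMonoOn ⟨ht.1.le, ht.2.le⟩ ⟨zero_le_one, le_rfl⟩ ht.2
  rw [hsys.g_zero] at h0
  exact ⟨h0, h1.trans_le (hsys.g_mem 1 ⟨zero_le_one, le_rfl⟩).2⟩

theorem singlePotential_eq (hsys : ScalarAdmissible f g) (hε : ε ∈ Icc (0 : ℝ) 1)
    {x : ℝ} (hx : x ∈ Icc (0 : ℝ) 1) :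
    singlePotential f g x ε = x * g x - (∫ t in (0 : ℝ)..x, unitExtend g t)
      - ∫ t in (0 : ℝ)..g x, unitExtend (fun s => f s ε) t := by
  have hG := continuous_unitExtend hsys.g_smooth.continuousOn
  have hF := continuous_unitExtend (hsys.f_continuousOn hε)
  have hsub : Icc 0 x ⊆ Icc (0 : ℝ) 1 := Icc_subset_Icc_right hx.2
  have hg : ContinuousOn g (Icc 0 x) := hsys.g_smooth.continuousOn.mono hsub
  have hfg : ContinuousOn (fun z => f (g z) ε) (Icc 0 x) :=
    (hsys.f_continuousOn hε).comp hg fun z hz => hsys.g_mem z (hsub hz)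
  have hIoo : ∀ z ∈ Ioo 0 x, z ∈ Ioo (0 : ℝ) 1 := fun z hz => ⟨hz.1, hz.2.trans_le hx.2⟩
  have key := intervalIntegral.integral_eq_sub_of_hasDerivAt_of_le
    (f := fun z => z * g z - (∫ t in (0 : ℝ)..z, unitExtend g t)
      - ∫ t in (0 : ℝ)..g z, unitExtend (fun s => f s ε) t)
    (f' := fun z => (z - f (g z) ε) * deriv g z) hx.1 ?_ ?_ ?_
  · simpa [singlePotential, hsys.g_zero] using key
  · have h1 : Continuous fun z => ∫ t in (0 : ℝ)..z, unitExtend g t :=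
      intervalIntegral.continuous_primitive (fun _ _ => hG.intervalIntegrable _ _) 0
    have h2 : Continuous fun z => ∫ t in (0 : ℝ)..z, unitExtend (fun s => f s ε) t :=
      intervalIntegral.continuous_primitive (fun _ _ => hF.intervalIntegrable _ _) 0
    exact ((continuousOn_id.mul hg).sub h1.continuousOn).sub (h2.comp_continuousOn hg)
  · intro z hz
    have hz1 := hIoo z hz
    have hzI : z ∈ Icc (0 : ℝ) 1 := Ioo_subset_Icc_self hz1
    have hd := hsys.hasDerivAt_g hz1
    have hGd := (hG.integral_hasStrictDerivAt 0 z).hasDerivAt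
    have hFd := (hF.integral_hasStrictDerivAt 0 (g z)).hasDerivAt.comp z hd
    rw [unitExtend_of_mem _ hzI] at hGd
    rw [unitExtend_of_mem _ (hsys.g_mem z hzI)] at hFd
    refine ((((hasDerivAt_id z).mul hd).sub hGd).sub hFd).congr_deriv ?_
    simp only [id]
    ring
  · have hmm : ∀ z ∈ Ioo (min 0 x) (max 0 x), z ∈ Ioo (0 : ℝ) 1 := by
      rw [min_eq_left hx.1, max_eq_right hx.1]; exact hIoo
    refine (intervalIntegral.intervalIntegrable_deriv_of_nonneg (g := g) ?_
      (fun z hz => hsys.hasDerivAt_g (hmm z hz))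
      fun z hz => (hsys.g_deriv_pos z (hmm z hz)).le).continuousOn_mul ?_
    · rwa [uIcc_of_le hx.1]
    · rw [uIcc_of_le hx.1]; exact continuousOn_id.sub hfg

theorem continuousOn_singlePotential (hsys : ScalarAdmissible f g) (hε : ε ∈ Icc (0 : ℝ) 1) :
    ContinuousOn (fun x => singlePotential f g x ε) (Icc 0 1) := by
  have hG := continuous_unitExtend hsys.g_smooth.continuousOn
  have hF := continuous_unitExtend (hsys.f_continuousOn hε)
  have hg := hsys.g_smooth.continuousOn
  have h1 : Continuous fun z => ∫ t in (0 : ℝ)..z, unitExtend g t :=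
    intervalIntegral.continuous_primitive (fun _ _ => hG.intervalIntegrable _ _) 0
  have h2 : Continuous fun z => ∫ t in (0 : ℝ)..z, unitExtend (fun s => f s ε) t :=
    intervalIntegral.continuous_primitive (fun _ _ => hF.intervalIntegrable _ _) 0
  exact (((continuousOn_id.mul hg).sub h1.continuousOn).sub (h2.comp_continuousOn hg)).congr
    fun x hx => hsys.singlePotential_eq hε hx

theorem uFix_mem (f : ℝ → ℝ → ℝ) (g : ℝ → ℝ) (ε : ℝ) : uFix f g ε ∈ Icc (0 : ℝ) 1 :=
  ⟨Real.sSup_nonneg fun _ hy => hy.1.1, Real.sSup_le (fun _ hy => hy.1.2) zero_le_one⟩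

theorem uFix_set_nonempty (f : ℝ → ℝ → ℝ) (g : ℝ → ℝ) (ε : ℝ) :
    {xt : ℝ | xt ∈ Icc (0 : ℝ) 1 ∧ ∀ x : ℝ, 0 < x → x < xt → f (g x) ε < x}.Nonempty :=
  ⟨0, ⟨le_rfl, zero_le_one⟩, fun _ h0 h1 => absurd (h0.trans h1) (lt_irrefl 0)⟩

theorem lt_of_lt_uFix {x : ℝ} (hx : 0 < x) (h : x < uFix f g ε) : f (g x) ε < x := by
  obtain ⟨t, ht, hxt⟩ := exists_lt_of_lt_csSup (uFix_set_nonempty f g ε) h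
  exact ht.2 x hx hxt

theorem uFix_anti (hsys : ScalarAdmissible f g) (hε : 0 ≤ ε) (hε' : ε' ≤ 1) (h : ε < ε') :
    uFix f g ε' ≤ uFix f g ε := by
  refine csSup_le_csSup ⟨1, fun y hy => hy.1.2⟩ (uFix_set_nonempty f g ε') ?_
  rintro t ⟨ht, hlt⟩
  refine ⟨ht, fun x hx hxt => lt_trans ?_ (hlt x hx hxt)⟩
  have := hsys.g_mem_Ioo ⟨hx, hxt.trans_le ht.2⟩
  exact hsys.f_lt_of_lt hε hε' h ⟨this.1, this.2.le⟩

theorem singlePotential_strictAnti (hsys : ScalarAdmissible f g) (hε : 0 ≤ ε) (hε' : ε' ≤ 1)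
    (h : ε < ε') {x : ℝ} (hx : x ∈ Ioc (0 : ℝ) 1) :
    singlePotential f g x ε' < singlePotential f g x ε := by
  have hxI : x ∈ Icc (0 : ℝ) 1 := ⟨hx.1.le, hx.2⟩
  have hm : ε ∈ Icc (0 : ℝ) 1 := ⟨hε, by linarith⟩
  have hm' : ε' ∈ Icc (0 : ℝ) 1 := ⟨by linarith, hε'⟩
  have hi := (continuous_unitExtend (hsys.f_continuousOn hm)).intervalIntegrable
    (μ := volume) 0 (g x)
  have hi' := (continuous_unitExtend (hsys.f_continuousOn hm')).intervalIntegrable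
    (μ := volume) 0 (g x)
  have hgx : 0 < g x := by
    simpa only [hsys.g_zero] using hsys.g_strictMonoOn ⟨le_rfl, zero_le_one⟩ hxI hx.1
  have hpos := intervalIntegral.intervalIntegral_pos_of_pos_on (hi'.sub hi) (fun t ht => ?_) hgx
  · rw [intervalIntegral.integral_sub hi' hi] at hpos
    rw [hsys.singlePotential_eq hm hxI, hsys.singlePotential_eq hm' hxI]
    linarith
  · have ht1 : t ≤ 1 := ht.2.le.trans (hsys.g_mem x hxI).2
    rw [unitExtend_of_mem _ ⟨ht.1.le, ht1⟩, unitExtend_of_mem _ ⟨ht.1.le, ht1⟩, sub_pos]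
    exact hsys.f_lt_of_lt hε hε' h ⟨ht.1, ht1⟩

theorem energyGap_le (hsys : ScalarAdmissible f g) (hε : ε ∈ Icc (0 : ℝ) 1) {x : ℝ}
    (hx : x ∈ Icc (uFix f g ε) 1) : energyGap f g ε ≤ singlePotential f g x ε :=
  csInf_le (isCompact_Icc.image_of_continuousOn ((hsys.continuousOn_singlePotential hε).mono
    (Icc_subset_Icc_left (uFix_mem f g ε).1))).bddBelow (mem_image_of_mem _ hx)

theorem energyGap_pos (hsys : ScalarAdmissible f g) (hε : ε ∈ Icc (0 : ℝ) 1)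
    (hlt : ε < potentialThreshold f g) : 0 < energyGap f g ε := by
  have hne : {ε : ℝ | ε ∈ Icc (0 : ℝ) 1 ∧ 0 < uFix f g ε ∧ 0 ≤ energyGap f g ε}.Nonempty := by
    by_contra hne
    rw [potentialThreshold, not_nonempty_iff_eq_empty.1 hne, Real.sSup_empty] at hlt
    exact hlt.not_ge hε.1
  obtain ⟨ε', ⟨hε', hu, hE⟩, hεε'⟩ := exists_lt_of_lt_csSup hne hlt
  have hanti := hsys.uFix_anti hε.1 hε'.2 hεε'
  obtain ⟨x, hx, hxE⟩ := (isCompact_Icc.image_of_continuousOn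
    ((hsys.continuousOn_singlePotential hε).mono
      (Icc_subset_Icc_left (uFix_mem f g ε).1))).sInf_mem
    ((nonempty_Icc.2 (uFix_mem f g ε).2).image _)
  have h1 := hsys.energyGap_le hε' (x := x) ⟨hanti.trans hx.1, hx.2⟩
  have h2 := hsys.singlePotential_strictAnti hε.1 hε'.2 hεε' (x := x)
    ⟨hu.trans_le (hanti.trans hx.1), hx.2⟩
  have h3 : singlePotential f g x ε = energyGap f g ε := hxE
  linarith

theorem bddAbove_abs_deriv_g (hsys : ScalarAdmissible f g) :
    BddAbove ((fun x => |deriv g x|) '' Icc (0 : ℝ) 1) := by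
  have hc := hsys.g_smooth.continuousOn_derivWithin uniqueDiffOn_Icc_zero_one (by norm_num)
  have hb : BddAbove ((fun x => |deriv g x|) '' Ioo (0 : ℝ) 1) := by
    refine (isCompact_Icc.image_of_continuousOn hc.abs).bddAbove.mono ?_
    rintro _ ⟨x, hx, rfl⟩
    refine ⟨x, Ioo_subset_Icc_self hx, ?_⟩
    simp only [derivWithin_of_mem_nhds (Icc_mem_nhds hx.1 hx.2)]
  rw [← Ioo_union_both zero_le_one, image_union]
  exact hb.union ((toFinite {(0 : ℝ), 1}).image _).bddAbove

theorem g_le_Kfg (hsys : ScalarAdmissible f g) {x : ℝ} (hx : x ∈ Icc (0 : ℝ) 1) :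
    g x ≤ Kfg f g := by
  have hS : ∀ c ∈ Icc (0 : ℝ) 1, |deriv g c| ≤ sSup ((fun x => |deriv g x|) '' Icc (0 : ℝ) 1) :=
    fun c hc => le_csSup hsys.bddAbove_abs_deriv_g (mem_image_of_mem _ hc)
  have hK : sSup ((fun x => |deriv g x|) '' Icc (0 : ℝ) 1) ≤ Kfg f g := by
    have h1 : 0 ≤ sSup ((fun p : ℝ × ℝ => |deriv (fun z => f z p.2) p.1|) ''
        (Icc (0 : ℝ) 1 ×ˢ Icc (0 : ℝ) 1)) :=
      Real.sSup_nonneg (by rintro _ ⟨p, _, rfl⟩; exact abs_nonneg _)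
    have h2 : 0 ≤ sSup ((fun x => |deriv (deriv g) x|) '' Icc (0 : ℝ) 1) :=
      Real.sSup_nonneg (by rintro _ ⟨p, _, rfl⟩; exact abs_nonneg _)
    have h3 := mul_nonneg (sq_nonneg (sSup ((fun x => |deriv g x|) '' Icc (0 : ℝ) 1))) h1
    rw [Kfg]
    linarith
  refine le_trans ?_ hK
  rcases hx.1.eq_or_lt with rfl | hx0
  · rw [hsys.g_zero]
    exact (abs_nonneg _).trans (hS 0 hx)
  obtain ⟨c, hc, hslope⟩ := exists_deriv_eq_slope g hx0
    (hsys.g_smooth.continuousOn.mono (Icc_subset_Icc_right hx.2)) fun t ht =>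
      (hsys.hasDerivAt_g ⟨ht.1, ht.2.trans_le hx.2⟩).differentiableAt.differentiableWithinAt
  rw [hsys.g_zero, sub_zero, sub_zero, eq_div_iff hx0.ne'] at hslope
  have hcI : c ∈ Icc (0 : ℝ) 1 := ⟨hc.1.le, hc.2.le.trans hx.2⟩
  calc g x = deriv g c * x := hslope.symm
    _ ≤ |deriv g c| * 1 := mul_le_mul (le_abs_self _) hx.2 hx.1 (abs_nonneg _)
    _ ≤ _ := by rw [mul_one]; exact hS c hcI

end ScalarAdmissible

/-- **Threshold saturation (main theorem).** For a scalar admissible system `(f,g)`,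
if `ε < ε*` and `w > K_{f,g}/ΔE(ε)`, then for every `L ≥ 1` the only fixed point of the
basic spatially-coupled system (values in `[0,1]` on `𝓛 = {−L,…,L+w−1}`, extended by
zero outside `𝓛`) is the all-zero vector. -/
theorem threshold_saturation (f : ℝ → ℝ → ℝ) (g : ℝ → ℝ) (hsys : ScalarAdmissible f g)
    (ε : ℝ) (hε : ε ∈ Icc (0:ℝ) 1) (hlt : ε < potentialThreshold f g)
    (w L : ℕ) (hw : 1 ≤ w) (hL : 1 ≤ L)
    (hwK : Kfg f g / energyGap f g ε < (w:ℝ))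
    (x : ℤ → ℝ) (hmem : ∀ i : ℤ, x i ∈ Icc (0:ℝ) 1)
    (hfix : ∀ i : ℤ, x i = scUpdate f g ε L w x i) :
    ∀ i : ℤ, x i = 0 := by
  have hε0 : (0 : ℝ) ∈ Icc (0 : ℝ) 1 := ⟨le_rfl, zero_le_one⟩
  have hw0 : (0 : ℝ) < w := by exact_mod_cast hw
  set F : ℝ → ℝ := unitExtend fun t => f t ε with hFdef
  set G : ℝ → ℝ := unitExtend g
  have hG : ∀ t ∈ Icc (0 : ℝ) 1, G t = g t := fun t ht => unitExtend_of_mem g ht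
  have hsupp : ∀ i : ℤ, ¬(-(L:ℤ) ≤ i ∧ i ≤ (L:ℤ) + (w:ℤ) - 1) → x i = 0 := fun i hi => by
    rw [hfix i, scUpdate, if_neg hi]
  have hFmem : ∀ t, F t ∈ Icc (0 : ℝ) 1 := fun t => hsys.f_mem _ (clamp_mem t) ε hε
  have havg : ∀ m : ℤ → ℤ, (1 / (w : ℝ)) * ∑ j ∈ Finset.range w, g (x (m j)) ∈ Icc (0 : ℝ) 1 := by
    refine fun m => ⟨mul_nonneg (by positivity)
      (Finset.sum_nonneg fun j _ => (hsys.g_mem _ (hmem _)).1), ?_⟩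
    rw [one_div_mul_eq_div, div_le_one hw0]
    refine (Finset.sum_le_card_nsmul _ _ 1 fun j _ => (hsys.g_mem _ (hmem _)).2).trans_eq ?_
    simp
  obtain ⟨h, hh, hxh, hfh, hU⟩ := energy_le_of_subsolution (F := F) (G := G)
    (monotone_unitExtend (hsys.f_monotoneOn hε))
    (monotone_unitExtend hsys.g_strictMonoOn.monotoneOn)
    (fun t => (hFmem t).1) (fun t => (hFmem t).2) (by rw [hG 0 hε0, hsys.g_zero]) hw hmem
    (l := -(L:ℤ)) (r := (L:ℤ) + (w:ℤ) - 1) (fun i hi => hsupp i (by omega))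
    (fun i hi => hsupp i (by omega)) (fun i => by
      rw [hfix i, scUpdate]
      split_ifs
      · rw [scPhi]
        refine mul_le_mul_of_nonneg_left (Finset.sum_le_sum fun k _ => ?_) (by positivity)
        have hm := havg fun j => i + j - k
        simp only [hG _ (hmem _)]
        rw [hFdef, unitExtend_of_mem _ hm, epsAt]
        split_ifs
        · exact le_rfl
        · rw [hsys.f_zero_right _ hm]
          exact (hsys.f_mem _ hm ε hε).1
      · exact mul_nonneg (by positivity) (Finset.sum_nonneg fun k _ => (hFmem _).1))
  rw [hG h hh] at hfh hU
  rw [hFdef, unitExtend_of_mem _ (hsys.g_mem h hh)] at hfh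
  rw [← hsys.singlePotential_eq hε hh] at hU
  have hh0 : h = 0 := by
    by_contra hne
    have hpos : 0 < h := hh.1.lt_of_ne' hne
    have hu : uFix f g ε ≤ h := le_of_not_gt fun hlt' =>
      (ScalarAdmissible.lt_of_lt_uFix hpos hlt').not_ge hfh
    have hgap := hsys.energyGap_pos hε hlt
    have hle := (hsys.energyGap_le hε ⟨hu, hh.2⟩).trans hU
    rw [div_lt_iff₀ hgap] at hwK
    rw [le_div_iff₀ hw0] at hle
    linarith [hsys.g_le_Kfg hh]
  exact fun i => le_antisymm (hh0 ▸ hxh i) (hmem i).1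
end
end

section
/- For the GLDPC density-evolution system with f(x;ε) = εx and g(x) = Σ_{e=t}^{n−1} C(n−1,e) x^e (1−x)^{n−1−e}, where 2 ≤ t ≤ ⌊(n−1)/2⌋: if ε < ε̄ (the unique ε-value x̄/g(x̄) at the unique root x̄ ∈ (0,1] of P) and w > K_{f,g}/ΔE(ε), then for every L ≥ 1 the only fixed point of the basic spatially-coupled density-evolution recursion is the all-zero vector. -/
open MeasureTheory Set Filter Topology

noncomputable section

/-- `g(x) = Σ_{e=t}^{n−1} C(n−1,e) xᵉ (1−x)^{n−1−e}`, the check-node update of the GLDPC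
density evolution (degree-2 bits, length-`n` BCH constraints correcting `t` erasures). -/
def gldpcG (n t : ℕ) (x : ℝ) : ℝ :=
  ∑ e ∈ Finset.Icc t (n - 1), ((n - 1).choose e : ℝ) * x ^ e * (1 - x) ^ (n - 1 - e)

/-- `P(x) = −x g(x) + 2 ∫₀ˣ g(z) dz`. -/
def gldpcP (n t : ℕ) (x : ℝ) : ℝ :=
  -x * gldpcG n t x + 2 * ∫ z in (0:ℝ)..x, gldpcG n t z

/-! ### The binomial tail -/

lemma gldpcG_eq_eval (n t : ℕ) (x : ℝ) :
    gldpcG n t x = (∑ e ∈ Finset.Icc t (n - 1), bernsteinPolynomial ℝ (n - 1) e).eval x := by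
  simp [gldpcG, bernsteinPolynomial, Polynomial.eval_finsetSum]

lemma derivative_sum_bernsteinPolynomial (m s : ℕ) (h : s ≤ m) :
    Polynomial.derivative (∑ e ∈ Finset.Icc (s + 1) m, bernsteinPolynomial ℝ m e) =
      m * (bernsteinPolynomial ℝ (m - 1) s - bernsteinPolynomial ℝ (m - 1) m) := by
  have key : ∀ r, s ≤ r →
      Polynomial.derivative (∑ e ∈ Finset.Icc (s + 1) r, bernsteinPolynomial ℝ m e) =
        m * (bernsteinPolynomial ℝ (m - 1) s - bernsteinPolynomial ℝ (m - 1) r) := by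
    intro r hr
    induction r, hr using Nat.le_induction with
    | base => simp
    | succ r hr ih =>
      rw [Finset.sum_Icc_succ_top (by omega), Polynomial.derivative_add, ih,
        bernsteinPolynomial.derivative_succ]
      ring
  exact key m h

lemma hasDerivAt_gldpcG {n s : ℕ} (h : s + 1 ≤ n - 1) (x : ℝ) :
    HasDerivAt (gldpcG n (s + 1))
      (((n - 1 : ℕ) : ℝ) * (bernsteinPolynomial ℝ (n - 1 - 1) s).eval x) x := by
  have h1 : gldpcG n (s + 1) = fun x =>
      (∑ e ∈ Finset.Icc (s + 1) (n - 1), bernsteinPolynomial ℝ (n - 1) e).eval x :=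
    funext fun x => gldpcG_eq_eval n (s + 1) x
  rw [h1]
  refine (Polynomial.hasDerivAt _ x).congr_deriv ?_
  rw [derivative_sum_bernsteinPolynomial _ _ (by omega),
    bernsteinPolynomial.eq_zero_of_lt (R := ℝ) (show n - 1 - 1 < n - 1 by omega)]
  simp

lemma continuous_gldpcG (n t : ℕ) : Continuous (gldpcG n t) := by
  unfold gldpcG
  fun_prop

lemma gldpcG_zero {n t : ℕ} (ht : 1 ≤ t) : gldpcG n t 0 = 0 := by
  refine Finset.sum_eq_zero fun e he => ?_
  have : e ≠ 0 := by have := (Finset.mem_Icc.1 he).1; omega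
  simp [this]

lemma gldpcG_one {n t : ℕ} (ht : t ≤ n - 1) : gldpcG n t 1 = 1 := by
  unfold gldpcG
  rw [Finset.sum_eq_single (n - 1)]
  · simp
  · intro e he hne
    have : n - 1 - e ≠ 0 := by have := (Finset.mem_Icc.1 he).2; omega
    simp [this]
  · intro h
    exact absurd (Finset.mem_Icc.2 ⟨ht, le_rfl⟩) h

lemma eval_bernsteinPolynomial_nonneg (m k : ℕ) {x : ℝ} (hx : x ∈ Icc (0:ℝ) 1) :
    0 ≤ (bernsteinPolynomial ℝ m k).eval x := by
  have h0 := hx.1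
  have h1 : 0 ≤ 1 - x := by linarith [hx.2]
  simp only [bernsteinPolynomial, Polynomial.eval_mul, Polynomial.eval_natCast,
    Polynomial.eval_pow, Polynomial.eval_X, Polynomial.eval_sub, Polynomial.eval_one]
  positivity

lemma monotoneOn_gldpcG {n s : ℕ} (h : s + 1 ≤ n - 1) :
    MonotoneOn (gldpcG n (s + 1)) (Icc 0 1) := by
  refine monotoneOn_of_hasDerivWithinAt_nonneg (convex_Icc 0 1)
    (continuous_gldpcG _ _).continuousOn
    (fun x _ => (hasDerivAt_gldpcG h x).hasDerivWithinAt) fun x hx => ?_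
  have := eval_bernsteinPolynomial_nonneg (n - 1 - 1) s (interior_subset hx)
  positivity

lemma gldpcG_mem_Icc {n s : ℕ} (h : s + 1 ≤ n - 1) {x : ℝ} (hx : x ∈ Icc (0:ℝ) 1) :
    gldpcG n (s + 1) x ∈ Icc (0:ℝ) 1 := by
  have h0 := monotoneOn_gldpcG h (left_mem_Icc.2 zero_le_one) hx hx.1
  have h1 := monotoneOn_gldpcG h hx (right_mem_Icc.2 zero_le_one) hx.2
  rw [gldpcG_zero (by omega)] at h0
  rw [gldpcG_one h] at h1
  exact ⟨h0, h1⟩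

lemma le_gldpcG {n t : ℕ} (h : t ≤ n - 1) {x : ℝ} (hx : x ∈ Icc (0:ℝ) 1) :
    ((n - 1).choose t : ℝ) * x ^ t * (1 - x) ^ (n - 1 - t) ≤ gldpcG n t x := by
  have h0 := hx.1
  have h1 : 0 ≤ 1 - x := by linarith [hx.2]
  exact Finset.single_le_sum
    (f := fun e => ((n - 1).choose e : ℝ) * x ^ e * (1 - x) ^ (n - 1 - e))
    (fun e _ => by positivity) (Finset.mem_Icc.2 ⟨le_rfl, h⟩)

lemma gldpcG_pos {n s : ℕ} (h : s + 1 ≤ n - 1) {x : ℝ} (hx : x ∈ Ioc (0:ℝ) 1) :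
    0 < gldpcG n (s + 1) x := by
  rcases hx.2.lt_or_eq with hlt | rfl
  · refine lt_of_lt_of_le ?_ (le_gldpcG h (Ioc_subset_Icc_self hx))
    have h0 := hx.1
    have h1 : 0 < 1 - x := by linarith
    have : (0:ℝ) < (n - 1).choose (s + 1) := by exact_mod_cast Nat.choose_pos h
    positivity
  · rw [gldpcG_one h]
    exact one_pos

lemma gldpcG_le {n s : ℕ} (h : s + 1 ≤ n - 1) {x : ℝ} (hx : x ∈ Icc (0:ℝ) 1) :
    gldpcG n (s + 1) x ≤ ((n - 1).choose (s + 1) : ℝ) * x ^ (s + 1) := by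
  have hmono : MonotoneOn
      (fun x : ℝ => ((n - 1).choose (s + 1) : ℝ) * x ^ (s + 1) - gldpcG n (s + 1) x)
      (Icc 0 1) := by
    refine monotoneOn_of_hasDerivWithinAt_nonneg (convex_Icc 0 1)
      (by have := continuous_gldpcG n (s + 1); fun_prop)
      (fun x _ => (((hasDerivAt_pow (s + 1) x).const_mul _).sub
        (hasDerivAt_gldpcG h x)).hasDerivWithinAt) fun x hx => ?_
    have hx := interior_subset hx
    have h0 := hx.1
    have h1 : 0 ≤ 1 - x := by linarith [hx.2]
    have hc : ((n - 1).choose (s + 1) : ℝ) * ((s + 1 : ℕ) : ℝ)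
        = ((n - 1 : ℕ) : ℝ) * ((n - 1 - 1).choose s : ℝ) := by
      obtain ⟨m, hm⟩ : ∃ m, n - 1 = m + 1 := ⟨n - 1 - 1, by omega⟩
      rw [hm]
      exact_mod_cast (Nat.add_one_mul_choose_eq m s).symm
    have hp : (1 - x) ^ (n - 1 - 1 - s) ≤ 1 := pow_le_one₀ h1 (by linarith)
    simp only [bernsteinPolynomial, Polynomial.eval_mul, Polynomial.eval_natCast,
      Polynomial.eval_pow, Polynomial.eval_X, Polynomial.eval_sub, Polynomial.eval_one,
      Nat.add_sub_cancel]
    rw [← mul_assoc, hc]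
    have : 0 ≤ ((n - 1 : ℕ) : ℝ) * ((n - 1 - 1).choose s : ℝ) * x ^ s := by positivity
    nlinarith
  have := hmono (left_mem_Icc.2 zero_le_one) hx hx.1
  simp only [gldpcG_zero (n := n) (t := s + 1) (by omega)] at this
  simpa using this

lemma integral_bernsteinPolynomial {m e : ℕ} (he : e ≤ m) :
    ∫ z in (0:ℝ)..1, (bernsteinPolynomial ℝ m e).eval z = 1 / ((m : ℝ) + 1) := by
  have hm : (m : ℝ) + 1 ≠ 0 := by positivity
  have h := intervalIntegral.integral_eq_sub_of_hasDerivAt (a := 0) (b := 1)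
    (fun x _ => hasDerivAt_gldpcG (n := m + 2) (s := e) (by omega) x)
    (Continuous.intervalIntegrable (by fun_prop) _ _)
  rw [gldpcG_one (by omega), gldpcG_zero (by omega)] at h
  simp only [intervalIntegral.integral_const_mul, show m + 2 - 1 = m + 1 by omega,
    Nat.add_sub_cancel, Nat.cast_add, Nat.cast_one, sub_zero] at h
  field_simp
  linarith

lemma integral_gldpcG {n t : ℕ} (hn : 1 ≤ n) (ht : t ≤ n) :
    ∫ z in (0:ℝ)..1, gldpcG n t z = ((n : ℝ) - t) / n := by
  simp only [gldpcG_eq_eval, Polynomial.eval_finsetSum]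
  rw [intervalIntegral.integral_finsetSum
    fun e _ => Continuous.intervalIntegrable (by fun_prop) _ _]
  rw [Finset.sum_congr rfl fun e he => integral_bernsteinPolynomial (Finset.mem_Icc.1 he).2]
  rw [Finset.sum_const, Nat.card_Icc, Nat.sub_add_cancel hn, nsmul_eq_mul, Nat.cast_sub ht,
    Nat.cast_sub hn]
  simp [div_eq_mul_inv]

/-! ### The sign of `P` and positivity of the potential -/

lemma hasDerivAt_integral_gldpcG (n t : ℕ) (x : ℝ) :
    HasDerivAt (fun x => ∫ z in (0:ℝ)..x, gldpcG n t z) (gldpcG n t x) x :=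
  intervalIntegral.integral_hasDerivAt_right ((continuous_gldpcG n t).intervalIntegrable _ _)
    ((continuous_gldpcG n t).stronglyMeasurableAtFilter _ _) (continuous_gldpcG n t).continuousAt

lemma continuous_integral_gldpcG (n t : ℕ) :
    Continuous (fun x => ∫ z in (0:ℝ)..x, gldpcG n t z) :=
  continuous_iff_continuousAt.2 fun x => (hasDerivAt_integral_gldpcG n t x).continuousAt

lemma continuous_gldpcP (n t : ℕ) : Continuous (gldpcP n t) := by
  have h1 := continuous_gldpcG n t
  have h2 := continuous_integral_gldpcG n t
  unfold gldpcP
  fun_prop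

lemma gldpcP_one_pos {n t : ℕ} (hn : 2 * t < n) : 0 < gldpcP n t 1 := by
  have hn0 : (0:ℝ) < n := by exact_mod_cast (by omega : 0 < n)
  have hn' : (2:ℝ) * t < n := by exact_mod_cast hn
  rw [gldpcP, gldpcG_one (by omega), integral_gldpcG (by omega) (by omega)]
  field_simp
  linarith

lemma exists_gldpcP_neg {n s : ℕ} (hs : 1 ≤ s) (h : s + 1 ≤ n - 1) :
    ∃ δ ∈ Ioo (0:ℝ) 1, ∀ x ∈ Ioc (0:ℝ) δ, gldpcP n (s + 1) x < 0 := by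
  have hcont : Tendsto (fun x : ℝ => (1 - x) ^ (n - 1 - (s + 1))) (𝓝 0) (𝓝 1) := by
    have : Continuous (fun x : ℝ => (1 - x) ^ (n - 1 - (s + 1))) := by fun_prop
    simpa using this.tendsto 0
  have hev := hcont.eventually (lt_mem_nhds (show (2/3:ℝ) < 1 by norm_num))
  obtain ⟨r, hr, hball⟩ := Metric.eventually_nhds_iff.1 hev
  refine ⟨min (r / 2) (1 / 2), ⟨by positivity, ?_⟩, fun x hx => ?_⟩
  · exact (min_le_right _ _).trans_lt (by norm_num)
  have hx0 := hx.1
  have hxr : x ≤ r / 2 := hx.2.trans (min_le_left _ _)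
  have hx1 : x ≤ 1 := by linarith [hx.2.trans (min_le_right _ _)]
  have hq : 2 / 3 < (1 - x) ^ (n - 1 - (s + 1)) := hball (by
    rw [Real.dist_eq, sub_zero, abs_of_pos hx0]; linarith)
  have hC : (0:ℝ) < (n - 1).choose (s + 1) := by exact_mod_cast Nat.choose_pos h
  set C : ℝ := ((n - 1).choose (s + 1) : ℝ) with hCdef
  have hlow := le_gldpcG h ⟨hx0.le, hx1⟩
  have hup : ∫ z in (0:ℝ)..x, gldpcG n (s + 1) z ≤ ∫ z in (0:ℝ)..x, C * z ^ (s + 1) :=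
    intervalIntegral.integral_mono_on hx0.le ((continuous_gldpcG _ _).intervalIntegrable _ _)
      (Continuous.intervalIntegrable (by fun_prop) _ _)
      fun z hz => gldpcG_le h ⟨hz.1, hz.2.trans hx1⟩
  rw [intervalIntegral.integral_const_mul, integral_pow, zero_pow (by omega), sub_zero] at hup
  have hs3 : x ^ (s + 1 + 1) / (((s + 1 : ℕ) : ℝ) + 1) ≤ x ^ (s + 1 + 1) / 3 := by
    have : (3:ℝ) ≤ ((s + 1 : ℕ) : ℝ) + 1 := by
      have : (1:ℝ) ≤ s := by exact_mod_cast hs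
      push_cast; linarith
    gcongr
  have hA : 0 < C * x ^ (s + 1 + 1) := by positivity
  have h1 : x * gldpcG n (s + 1) x ≥ C * x ^ (s + 1 + 1) * (1 - x) ^ (n - 1 - (s + 1)) := by
    have := mul_le_mul_of_nonneg_left hlow hx0.le
    rw [← hCdef] at this
    calc _ = x * (C * x ^ (s + 1) * (1 - x) ^ (n - 1 - (s + 1))) := by ring
      _ ≤ _ := this
  have h2 := mul_le_mul_of_nonneg_left hs3 hC.le
  have h3 := mul_lt_mul_of_pos_left hq hA
  unfold gldpcP
  linarith

lemma gldpcP_neg_of_lt {n s : ℕ} (hs : 1 ≤ s) (h : s + 1 ≤ n - 1) {xbar : ℝ}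
    (hxbar : xbar ∈ Ioc (0:ℝ) 1)
    (huniq : ∀ y ∈ Ioc (0:ℝ) 1, gldpcP n (s + 1) y = 0 → y = xbar)
    {x : ℝ} (hx0 : 0 < x) (hx : x < xbar) : gldpcP n (s + 1) x < 0 := by
  by_contra! hP
  obtain ⟨δ, hδ, hneg⟩ := exists_gldpcP_neg hs h
  have hy : min δ x ∈ Ioc (0:ℝ) δ := ⟨lt_min hδ.1 hx0, min_le_left _ _⟩
  obtain ⟨y, hyI, hy0⟩ := intermediate_value_Icc (min_le_right δ x)
    (continuous_gldpcP n (s + 1)).continuousOn ⟨(hneg _ hy).le, hP⟩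
  have := huniq y ⟨hy.1.trans_le hyI.1, hyI.2.trans (hx.le.trans hxbar.2)⟩ hy0
  linarith [hyI.2]

lemma gldpcP_pos_of_gt {n t : ℕ} (hn : 2 * t < n) {xbar : ℝ} (hxbar : xbar ∈ Ioc (0:ℝ) 1)
    (huniq : ∀ y ∈ Ioc (0:ℝ) 1, gldpcP n t y = 0 → y = xbar)
    {x : ℝ} (hx : xbar < x) (hx1 : x ≤ 1) : 0 < gldpcP n t x := by
  by_contra! hP
  obtain ⟨y, hyI, hy0⟩ := intermediate_value_Icc hx1
    (continuous_gldpcP n t).continuousOn ⟨hP, (gldpcP_one_pos hn).le⟩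
  have := huniq y ⟨hxbar.1.trans (hx.trans_le hyI.1), hyI.2⟩ hy0
  linarith [hyI.1]

lemma hasDerivAt_mul_gldpcG_sub_integral {n s : ℕ} (h : s + 1 ≤ n - 1) (x : ℝ) :
    HasDerivAt (fun x => x * gldpcG n (s + 1) x - ∫ z in (0:ℝ)..x, gldpcG n (s + 1) z)
      (x * (((n - 1 : ℕ) : ℝ) * (bernsteinPolynomial ℝ (n - 1 - 1) s).eval x)) x := by
  refine (((hasDerivAt_id x).mul (hasDerivAt_gldpcG h x)).sub
    (hasDerivAt_integral_gldpcG n (s + 1) x)).congr_deriv ?_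
  simp

lemma singlePotential_gldpc {n s : ℕ} (h : s + 1 ≤ n - 1) (ε x : ℝ) :
    singlePotential (fun x ε' => ε' * x) (gldpcG n (s + 1)) x ε =
      x * gldpcG n (s + 1) x - (∫ z in (0:ℝ)..x, gldpcG n (s + 1) z)
        - ε * gldpcG n (s + 1) x ^ 2 / 2 := by
  have hd : deriv (gldpcG n (s + 1)) = fun x =>
      ((n - 1 : ℕ) : ℝ) * (bernsteinPolynomial ℝ (n - 1 - 1) s).eval x :=
    funext fun x => (hasDerivAt_gldpcG h x).deriv
  have hg := continuous_gldpcG n (s + 1)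
  have hF : ∀ y : ℝ, HasDerivAt
      (fun x => x * gldpcG n (s + 1) x - (∫ z in (0:ℝ)..x, gldpcG n (s + 1) z)
        - ε * gldpcG n (s + 1) x ^ 2 / 2)
      ((y - ε * gldpcG n (s + 1) y) * deriv (gldpcG n (s + 1)) y) y := by
    intro y
    refine ((hasDerivAt_mul_gldpcG_sub_integral h y).sub
      ((((hasDerivAt_gldpcG h y).pow 2).const_mul ε).div_const 2)).congr_deriv ?_
    rw [hd]
    simp only [Nat.cast_ofNat, Nat.add_one_sub_one, pow_one]
    ring
  have := intervalIntegral.integral_eq_sub_of_hasDerivAt (a := 0) (b := x) (fun y _ => hF y)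
    (Continuous.intervalIntegrable (by rw [hd]; fun_prop) _ _)
  rw [singlePotential, this]
  simp [gldpcG_zero (n := n) (t := s + 1) (by omega)]

lemma singlePotential_gldpc_pos {n s : ℕ} (hs : 1 ≤ s) (hn : 2 * (s + 1) < n)
    {xbar : ℝ} (hxbar : xbar ∈ Ioc (0:ℝ) 1) (hroot : gldpcP n (s + 1) xbar = 0)
    (huniq : ∀ y ∈ Ioc (0:ℝ) 1, gldpcP n (s + 1) y = 0 → y = xbar)
    {ε : ℝ} (hlt : ε < xbar / gldpcG n (s + 1) xbar) {x : ℝ} (hx : x ∈ Ioc (0:ℝ) 1) :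
    0 < singlePotential (fun x ε' => ε' * x) (gldpcG n (s + 1)) x ε := by
  have h : s + 1 ≤ n - 1 := by omega
  set g := gldpcG n (s + 1) with hg
  set H : ℝ → ℝ := fun x => x * g x - ∫ z in (0:ℝ)..x, g z with hH
  set b : ℝ → ℝ := fun x => ((n - 1 : ℕ) : ℝ) * (bernsteinPolynomial ℝ (n - 1 - 1) s).eval x
    with hb
  have hpos : ∀ y ∈ Ioc (0:ℝ) 1, 0 < g y := fun y hy => gldpcG_pos h hy
  have hb0 : ∀ y ∈ Ioc (0:ℝ) 1, 0 ≤ b y := fun y hy => by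
    have := eval_bernsteinPolynomial_nonneg (n - 1 - 1) s (Ioc_subset_Icc_self hy)
    positivity
  have hderiv : ∀ y ∈ Ioc (0:ℝ) 1,
      HasDerivAt (fun y => H y / g y ^ 2) (b y * gldpcP n (s + 1) y / g y ^ 3) y := by
    intro y hy
    have hgy := (hpos y hy).ne'
    refine ((hasDerivAt_mul_gldpcG_sub_integral h y).div ((hasDerivAt_gldpcG h y).pow 2)
      (pow_ne_zero 2 hgy)).congr_deriv ?_
    rw [gldpcP]
    simp only [← hg, hb, Pi.pow_apply]
    field_simp
    ring
  have hmin : H xbar / g xbar ^ 2 ≤ H x / g x ^ 2 := by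
    rcases le_total x xbar with hle | hle
    · have hI : Icc x xbar ⊆ Ioc (0:ℝ) 1 := fun y hy =>
        ⟨hx.1.trans_le hy.1, hy.2.trans hxbar.2⟩
      refine antitoneOn_of_hasDerivWithinAt_nonpos (convex_Icc x xbar)
        (fun y hy => (hderiv y (hI hy)).continuousAt.continuousWithinAt)
        (fun y hy => (hderiv y (hI (interior_subset hy))).hasDerivWithinAt) (fun y hy => ?_)
        (left_mem_Icc.2 hle) (right_mem_Icc.2 hle) hle
      rw [interior_Icc] at hy
      have hy' := hI (Ioo_subset_Icc_self hy)
      exact div_nonpos_of_nonpos_of_nonneg (mul_nonpos_of_nonneg_of_nonpos (hb0 y hy')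
        (gldpcP_neg_of_lt hs h hxbar huniq hy'.1 hy.2).le) (pow_nonneg (hpos y hy').le 3)
    · have hI : Icc xbar x ⊆ Ioc (0:ℝ) 1 := fun y hy =>
        ⟨hxbar.1.trans_le hy.1, hy.2.trans hx.2⟩
      refine monotoneOn_of_hasDerivWithinAt_nonneg (convex_Icc xbar x)
        (fun y hy => (hderiv y (hI hy)).continuousAt.continuousWithinAt)
        (fun y hy => (hderiv y (hI (interior_subset hy))).hasDerivWithinAt) (fun y hy => ?_)
        (left_mem_Icc.2 hle) (right_mem_Icc.2 hle) hle
      rw [interior_Icc] at hy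
      have hy' := hI (Ioo_subset_Icc_self hy)
      exact div_nonneg (mul_nonneg (hb0 y hy')
        (gldpcP_pos_of_gt hn hxbar huniq hy.1 hy'.2).le) (pow_nonneg (hpos y hy').le 3)
  have hval : H xbar / g xbar ^ 2 = xbar / g xbar / 2 := by
    have hgx := (hpos _ hxbar).ne'
    have : H xbar = xbar * g xbar / 2 := by
      rw [gldpcP] at hroot
      simp only [hH]
      linarith
    rw [this]
    field_simp
  have hgx := hpos x hx
  rw [hval, le_div_iff₀ (by positivity)] at hmin
  rw [singlePotential_gldpc h]
  have : ε * g x ^ 2 < xbar / g xbar * g x ^ 2 := by gcongr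
  simp only [hH] at hmin
  linarith

lemma continuous_singlePotential_gldpc {n s : ℕ} (h : s + 1 ≤ n - 1) (ε : ℝ) :
    Continuous fun x => singlePotential (fun x ε' => ε' * x) (gldpcG n (s + 1)) x ε := by
  have h1 := continuous_gldpcG n (s + 1)
  have h2 := continuous_integral_gldpcG n (s + 1)
  simp only [singlePotential_gldpc h]
  fun_prop

/-! ### The minimum unstable fixed point and the energy gap -/

lemma uFix_le_of_le {f : ℝ → ℝ → ℝ} {g : ℝ → ℝ} {ε c : ℝ} (hc : 0 < c)
    (h : c ≤ f (g c) ε) : uFix f g ε ≤ c := by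
  refine Real.sSup_le (fun y hy => ?_) hc.le
  by_contra! hlt
  exact absurd (hy.2 c hc hlt) (not_lt.2 h)

lemma uFix_le_one (f : ℝ → ℝ → ℝ) (g : ℝ → ℝ) (ε : ℝ) : uFix f g ε ≤ 1 :=
  Real.sSup_le (fun _ hy => hy.1.2) zero_le_one

lemma uFix_gldpc_pos {n s : ℕ} (hs : 1 ≤ s) (h : s + 1 ≤ n - 1) {ε : ℝ}
    (hε : ε ∈ Icc (0:ℝ) 1) :
    0 < uFix (fun x ε' => ε' * x) (gldpcG n (s + 1)) ε := by
  have hC : (1:ℝ) ≤ (n - 1).choose (s + 1) := by exact_mod_cast Nat.choose_pos h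
  have hC0 : (0:ℝ) < (n - 1).choose (s + 1) := by linarith
  set C : ℝ := ((n - 1).choose (s + 1) : ℝ) with hCdef
  have hC1 : 1 / C ≤ 1 := (div_le_one hC0).2 hC
  refine lt_of_lt_of_le (one_div_pos.2 hC0)
    (le_csSup ⟨1, fun _ hy => hy.1.2⟩ ⟨⟨by positivity, hC1⟩, fun x hx0 hx => ?_⟩)
  have hx1 : x ∈ Icc (0:ℝ) 1 := ⟨hx0.le, (hx.le.trans hC1)⟩
  have hgle := gldpcG_le h hx1
  have hg := gldpcG_mem_Icc h hx1
  have hxC : x * C < 1 := (lt_div_iff₀ hC0).1 hx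
  have hpow : x ^ (s + 1) ≤ x ^ 2 := pow_le_pow_of_le_one hx0.le hx1.2 (by omega)
  calc ε * gldpcG n (s + 1) x ≤ 1 * gldpcG n (s + 1) x :=
        mul_le_mul_of_nonneg_right hε.2 hg.1
    _ ≤ C * x ^ 2 := by rw [one_mul]; exact hgle.trans (by gcongr)
    _ = (x * C) * x := by ring
    _ < 1 * x := by gcongr
    _ = x := one_mul x

lemma energyGap_gldpc_le {n s : ℕ} (h : s + 1 ≤ n - 1) {ε c : ℝ}
    (hc : c ∈ Icc (uFix (fun x ε' => ε' * x) (gldpcG n (s + 1)) ε) 1) :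
    energyGap (fun x ε' => ε' * x) (gldpcG n (s + 1)) ε ≤
      singlePotential (fun x ε' => ε' * x) (gldpcG n (s + 1)) c ε :=
  csInf_le (isCompact_Icc.image (continuous_singlePotential_gldpc h ε)).bddBelow
    (mem_image_of_mem _ hc)

lemma energyGap_gldpc_pos {n s : ℕ} (hs : 1 ≤ s) (hn : 2 * (s + 1) < n)
    {xbar : ℝ} (hxbar : xbar ∈ Ioc (0:ℝ) 1) (hroot : gldpcP n (s + 1) xbar = 0)
    (huniq : ∀ y ∈ Ioc (0:ℝ) 1, gldpcP n (s + 1) y = 0 → y = xbar)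
    {ε : ℝ} (hε : ε ∈ Icc (0:ℝ) 1) (hlt : ε < xbar / gldpcG n (s + 1) xbar) :
    0 < energyGap (fun x ε' => ε' * x) (gldpcG n (s + 1)) ε := by
  have h : s + 1 ≤ n - 1 := by omega
  have hmem := (isCompact_Icc.image (continuous_singlePotential_gldpc h ε)).sInf_mem
    ((nonempty_Icc.2 (uFix_le_one (fun x ε' => ε' * x) (gldpcG n (s + 1)) ε)).image _)
  obtain ⟨x, hx, hxe⟩ := hmem
  rw [energyGap, ← hxe]
  exact singlePotential_gldpc_pos hs hn hxbar hroot huniq hlt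
    ⟨(uFix_gldpc_pos hs h hε).trans_le hx.1, hx.2⟩

lemma one_le_Kfg_gldpc {n s : ℕ} (h : s + 1 ≤ n - 1) :
    1 ≤ Kfg (fun x ε' => ε' * x) (gldpcG n (s + 1)) := by
  have hd : deriv (gldpcG n (s + 1)) = fun x =>
      ((n - 1 : ℕ) : ℝ) * (bernsteinPolynomial ℝ (n - 1 - 1) s).eval x :=
    funext fun x => (hasDerivAt_gldpcG h x).deriv
  have hcont : Continuous fun x => |deriv (gldpcG n (s + 1)) x| := by
    rw [hd]; fun_prop
  obtain ⟨y, hy, hyd⟩ := exists_deriv_eq_slope (gldpcG n (s + 1)) (zero_lt_one (α := ℝ))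
    (continuous_gldpcG _ _).continuousOn
    (fun x _ => (hasDerivAt_gldpcG h x).differentiableAt.differentiableWithinAt)
  rw [gldpcG_one h, gldpcG_zero (by omega)] at hyd
  have h1 : (1:ℝ) ≤ sSup ((fun x => |deriv (gldpcG n (s + 1)) x|) '' Icc (0:ℝ) 1) :=
    le_csSup (isCompact_Icc.image hcont).bddAbove
      ⟨y, Ioo_subset_Icc_self hy, by simp [hyd]⟩
  have nonneg {α : Type} (F : α → ℝ) (S : Set α) : 0 ≤ sSup ((fun x => |F x|) '' S) :=
    Real.sSup_nonneg (by rintro _ ⟨x, -, rfl⟩; exact abs_nonneg _)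
  have h2 := nonneg (fun p : ℝ × ℝ => deriv (fun z => p.2 * z) p.1)
    (Icc (0:ℝ) 1 ×ˢ Icc (0:ℝ) 1)
  have h3 := nonneg (fun x => deriv (deriv (gldpcG n (s + 1))) x) (Icc (0:ℝ) 1)
  have h4 := mul_nonneg
    (sq_nonneg (sSup ((fun x => |deriv (gldpcG n (s + 1)) x|) '' Icc (0:ℝ) 1))) h2
  unfold Kfg
  linarith

/-! ### Coupled profiles -/

lemma sum_Ico_int_sub (F : ℤ → ℝ) {a b : ℤ} (hab : a ≤ b) :
    ∑ i ∈ Finset.Ico a b, (F i - F (i - 1)) = F (b - 1) - F (a - 1) := by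
  induction b, hab using Int.leInduction with
  | base => simp
  | succ b hab ih =>
    rw [← Finset.insert_Ico_right_eq_Ico_add_one hab, Finset.sum_insert (by simp), ih]
    simp

/-- Double averaging of `g ∘ v` over windows of length `w`. -/
def windowAverage (g : ℝ → ℝ) (w : ℕ) (v : ℤ → ℝ) (i : ℤ) : ℝ :=
  (1 / (w:ℝ)) * ∑ k ∈ Finset.range w,
    (1 / (w:ℝ)) * ∑ j ∈ Finset.range w, g (v (i + (j:ℤ) - (k:ℤ)))

lemma windowAverage_mono {g : ℝ → ℝ} (hg : MonotoneOn g (Icc 0 1)) (w : ℕ) {u v : ℤ → ℝ}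
    {i i' : ℤ} (hu : ∀ i, u i ∈ Icc (0:ℝ) 1) (hv : ∀ i, v i ∈ Icc (0:ℝ) 1)
    (huv : ∀ d, u (i + d) ≤ v (i' + d)) :
    windowAverage g w u i ≤ windowAverage g w v i' := by
  unfold windowAverage
  gcongr with k _ j _
  refine hg (hu _) (hv _) ?_
  simpa only [add_sub_assoc] using huv ((j:ℤ) - (k:ℤ))

/-- The potential at the plateau of a monotone profile dominated by its own window average
is at most of order `1 / w`. -/
lemma plateau_potential_le {g H : ℝ → ℝ} (hg : MonotoneOn g (Icc 0 1))
    (hg01 : ∀ x ∈ Icc (0:ℝ) 1, g x ∈ Icc (0:ℝ) 1)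
    (hH : ∀ x ∈ Icc (0:ℝ) 1, ∀ y ∈ Icc (0:ℝ) 1, x ≤ y → H y - H x ≤ y * (g y - g x))
    {ε : ℝ} (hε : 0 ≤ ε) {w : ℕ} (hw : 1 ≤ w) {z : ℤ → ℝ} (hz : ∀ i, z i ∈ Icc (0:ℝ) 1)
    (hmono : Monotone z) (hsub : ∀ i, z i ≤ ε * windowAverage g w z i)
    {a b : ℤ} (hab : a ≤ b) {c : ℝ} (ha : z (a - 1) = 0) (hb : ∀ i, b - 1 ≤ i → z i = c) :
    H c - H 0 ≤ ε * (g c ^ 2 / 2 + 1 / (2 * w)) := by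
  have hw0 : (0:ℝ) < w := by exact_mod_cast hw
  set y : ℤ → ℝ := fun i => (1 / (w:ℝ)) * ∑ j ∈ Finset.range w, g (z (i + (j:ℤ))) with hy
  set γ : ℤ → ℝ := fun i => g (z i) - g (z (i - 1)) with hγ
  have hγ0 : ∀ i, 0 ≤ γ i := fun i =>
    sub_nonneg.2 (hg (hz _) (hz _) (hmono (by omega)))
  have hy0 : ∀ i, 0 ≤ y i := fun i =>
    mul_nonneg (by positivity) (Finset.sum_nonneg fun j _ => (hg01 _ (hz _)).1)
  have hdiff : ∀ i, y i - y (i - 1) = (1 / (w:ℝ)) * ∑ k ∈ Finset.range w, γ (i + (k:ℤ)) := by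
    intro i
    simp only [hy, hγ, Finset.sum_sub_distrib, mul_sub]
    simp only [show ∀ k : ℕ, i - 1 + (k:ℤ) = i + (k:ℤ) - 1 from fun k => by ring]
  have hdiff0 : ∀ i, 0 ≤ y i - y (i - 1) := fun i => by
    rw [hdiff]
    exact mul_nonneg (by positivity) (Finset.sum_nonneg fun k _ => hγ0 _)
  have hdiff1 : ∀ i, y i - y (i - 1) ≤ 1 / w := fun i => by
    have hs : ∑ k ∈ Finset.range w, γ (i + (k:ℤ)) = g (z (i + w - 1)) - g (z (i - 1)) := by
      have := Finset.sum_range_sub (fun k : ℕ => g (z (i + (k:ℤ) - 1))) w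
      simp only [Nat.cast_add, Nat.cast_one, ← add_assoc, add_sub_cancel_right, Nat.cast_zero,
        add_zero] at this
      exact this
    rw [hdiff, hs]
    have h1 := (hg01 _ (hz (i + w - 1))).2
    have h2 := (hg01 _ (hz (i - 1))).1
    have : g (z (i + w - 1)) - g (z (i - 1)) ≤ 1 := by linarith
    calc _ ≤ 1 / (w:ℝ) * 1 := by gcongr
      _ = _ := mul_one _
  have hyb : y (b - 1) = g c := by
    simp only [hy]
    rw [Finset.sum_congr rfl fun j _ => by rw [hb (b - 1 + (j:ℤ)) (by omega)]]
    simp [hw0.ne']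
  have hgc : g c ≤ 1 := by
    rw [← hb (b - 1) le_rfl]
    exact (hg01 _ (hz _)).2
  have hHsum : H c - H 0 ≤ ∑ i ∈ Finset.Ico a b, z i * γ i := by
    rw [← hb (b - 1) le_rfl, ← ha, ← sum_Ico_int_sub (fun i => H (z i)) hab]
    exact Finset.sum_le_sum fun i _ => hH _ (hz _) _ (hz _) (hmono (by omega))
  have hz_le : ∀ i, z i ≤ ε * ((1 / (w:ℝ)) * ∑ k ∈ Finset.range w, y (i - k)) := by
    intro i
    refine (hsub i).trans (le_of_eq ?_)
    simp only [windowAverage, hy, add_sub_right_comm]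
  have hshift : ∀ k ∈ Finset.range w, ∑ i ∈ Finset.Ico a b, y (i - (k:ℤ)) * γ i ≤
      ∑ i ∈ Finset.Ico (a - w) b, y i * γ (i + (k:ℤ)) := by
    intro k hk
    have hk := Finset.mem_range.1 hk
    have := Finset.sum_Ico_add' (fun i : ℤ => y (i - (k:ℤ)) * γ i) (a - k) (b - k) (k:ℤ)
    simp only [add_sub_cancel_right, sub_add_cancel] at this
    rw [← this]
    exact Finset.sum_le_sum_of_subset_of_nonneg
      (Finset.Ico_subset_Ico (by omega) (by omega))
      fun i _ _ => mul_nonneg (hy0 _) (hγ0 _)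
  have hsum : ∑ i ∈ Finset.Ico a b, z i * γ i ≤
      ε * ∑ i ∈ Finset.Ico (a - w) b, y i * (y i - y (i - 1)) := by
    calc ∑ i ∈ Finset.Ico a b, z i * γ i
        ≤ ∑ i ∈ Finset.Ico a b,
            ε * ((1 / (w:ℝ)) * ∑ k ∈ Finset.range w, y (i - k)) * γ i :=
          Finset.sum_le_sum fun i _ => mul_le_mul_of_nonneg_right (hz_le i) (hγ0 i)
      _ = ε * ((1 / (w:ℝ)) * ∑ k ∈ Finset.range w,
            ∑ i ∈ Finset.Ico a b, y (i - (k:ℤ)) * γ i) := by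
          rw [Finset.sum_comm]
          simp only [Finset.mul_sum, Finset.sum_mul, mul_assoc]
      _ ≤ ε * ((1 / (w:ℝ)) * ∑ k ∈ Finset.range w,
            ∑ i ∈ Finset.Ico (a - w) b, y i * γ (i + (k:ℤ))) := by
          gcongr with k hk
          exact hshift k hk
      _ = ε * ∑ i ∈ Finset.Ico (a - w) b, y i * (y i - y (i - 1)) := by
          rw [Finset.sum_comm]
          simp only [hdiff, Finset.mul_sum, mul_left_comm]
  have htel : ∑ i ∈ Finset.Ico (a - w) b, y i * (y i - y (i - 1)) ≤
      g c ^ 2 / 2 + 1 / (2 * w) := by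
    calc ∑ i ∈ Finset.Ico (a - w) b, y i * (y i - y (i - 1))
        ≤ ∑ i ∈ Finset.Ico (a - w) b,
            ((y i ^ 2 / 2 + y i / (2 * w)) - (y (i - 1) ^ 2 / 2 + y (i - 1) / (2 * w))) := by
          refine Finset.sum_le_sum fun i _ => ?_
          have h1 := mul_le_mul_of_nonneg_right (hdiff1 i) (hdiff0 i)
          have h2 : y i / (2 * w) - y (i - 1) / (2 * w) = 1 / w * (y i - y (i - 1)) / 2 := by
            field_simp
          nlinarith
      _ = (g c ^ 2 / 2 + g c / (2 * w)) -
            (y (a - w - 1) ^ 2 / 2 + y (a - w - 1) / (2 * w)) := by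
          rw [sum_Ico_int_sub (fun i => y i ^ 2 / 2 + y i / (2 * w)) (by omega), hyb]
      _ ≤ g c ^ 2 / 2 + g c / (2 * w) := by
          have := hy0 (a - w - 1)
          exact sub_le_self _ (by positivity)
      _ ≤ g c ^ 2 / 2 + 1 / (2 * w) := by gcongr
  exact hHsum.trans (hsum.trans (mul_le_mul_of_nonneg_left htel hε))

lemma le_windowAverage_of_fixed {g : ℝ → ℝ} (hg01 : ∀ x ∈ Icc (0:ℝ) 1, g x ∈ Icc (0:ℝ) 1)
    {ε : ℝ} (hε : 0 ≤ ε) (L w : ℕ) {x : ℤ → ℝ} (hmem : ∀ i, x i ∈ Icc (0:ℝ) 1) (i : ℤ) :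
    scUpdate (fun x' ε' => ε' * x') g ε L w x i ≤ ε * windowAverage g w x i := by
  have hA : ∀ k : ℕ, 0 ≤ (1 / (w:ℝ)) * ∑ j ∈ Finset.range w, g (x (i + (j:ℤ) - (k:ℤ))) :=
    fun k => mul_nonneg (by positivity) (Finset.sum_nonneg fun j _ => (hg01 _ (hmem _)).1)
  unfold scUpdate
  split_ifs
  · unfold scPhi windowAverage
    rw [mul_left_comm, Finset.mul_sum (a := ε)]
    gcongr with k _
    refine mul_le_mul_of_nonneg_right ?_ (hA k)
    unfold epsAt
    split_ifs
    · exact le_rfl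
    · exact hε
  · exact mul_nonneg hε (mul_nonneg (by positivity) (Finset.sum_nonneg fun k _ => hA k))

/-- A profile vanishing outside a finite window and dominated by its window average has a
running maximum with the same property. -/
lemma exists_monotone_majorant {g : ℝ → ℝ} (hg : MonotoneOn g (Icc 0 1)) {ε : ℝ} (hε : 0 ≤ ε)
    (w : ℕ) {x : ℤ → ℝ} (hmem : ∀ i, x i ∈ Icc (0:ℝ) 1)
    (hsub : ∀ i, x i ≤ ε * windowAverage g w x i)
    {a b : ℤ} (ha : ∀ i < a, x i = 0) (hb : ∀ i ≥ b, x i = 0) :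
    ∃ z : ℤ → ℝ, (∀ i, z i ∈ Icc (0:ℝ) 1) ∧ Monotone z ∧
      (∀ i, z i ≤ ε * windowAverage g w z i) ∧ z (a - 1) = 0 ∧
      (∀ i ≥ b, z i = z b) ∧ ∀ i, x i ≤ z b := by
  set z : ℤ → ℝ := fun i => ⨆ j : Set.Iic i, x (j : ℤ)
  have hbdd : ∀ i : ℤ, BddAbove (range fun j : Set.Iic i => x (j : ℤ)) := fun i =>
    ⟨1, by rintro _ ⟨j, rfl⟩; exact (hmem _).2⟩
  have hle : ∀ i j, j ≤ i → x j ≤ z i := fun i j hj => le_ciSup (hbdd i) ⟨j, hj⟩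
  have hsup : ∀ i (r : ℝ), (∀ j ≤ i, x j ≤ r) → z i ≤ r := fun i r h =>
    haveI : Nonempty (Set.Iic i) := ⟨⟨i, Set.mem_Iic.2 le_rfl⟩⟩
    ciSup_le fun j => h j j.2
  have hz : ∀ i, z i ∈ Icc (0:ℝ) 1 := fun i =>
    ⟨(hmem i).1.trans (hle i i le_rfl), hsup i 1 fun j _ => (hmem j).2⟩
  have hmono : Monotone z := fun i i' h => hsup i _ fun j hj => hle i' j (hj.trans h)
  have htop : ∀ i, x i ≤ z b := fun i => by
    rcases le_total i b with h | h
    · exact hle b i h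
    · rw [hb i h]
      exact (hz b).1
  refine ⟨z, hz, hmono, fun i => hsup i _ fun j hj => (hsub j).trans ?_, ?_, ?_, htop⟩
  · refine mul_le_mul_of_nonneg_left (windowAverage_mono hg w hmem hz fun d => ?_) hε
    exact hle _ _ (by omega)
  · exact le_antisymm (hsup _ _ fun j hj => (ha j (by omega)).le) (hz _).1
  · exact fun i hi => le_antisymm (hsup i _ fun j _ => htop j) (hmono hi)

lemma mul_gldpcG_sub_integral_le {n s : ℕ} (h : s + 1 ≤ n - 1) :
    ∀ x ∈ Icc (0:ℝ) 1, ∀ y ∈ Icc (0:ℝ) 1, x ≤ y →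
      (y * gldpcG n (s + 1) y - ∫ z in (0:ℝ)..y, gldpcG n (s + 1) z) -
        (x * gldpcG n (s + 1) x - ∫ z in (0:ℝ)..x, gldpcG n (s + 1) z) ≤
      y * (gldpcG n (s + 1) y - gldpcG n (s + 1) x) := by
  intro x hx y hy hxy
  have hint : ∀ u v : ℝ, IntervalIntegrable (gldpcG n (s + 1)) volume u v :=
    fun u v => (continuous_gldpcG _ _).intervalIntegrable u v
  have h1 := intervalIntegral.integral_interval_sub_left (hint 0 y) (hint 0 x)
  have h2 : ∫ _ in x..y, gldpcG n (s + 1) x ≤ ∫ z in x..y, gldpcG n (s + 1) z :=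
    intervalIntegral.integral_mono_on hxy intervalIntegrable_const (hint x y)
      fun z hz => monotoneOn_gldpcG h hx ⟨hx.1.trans hz.1, hz.2.trans hy.2⟩ hz.1
  rw [intervalIntegral.integral_const, smul_eq_mul] at h2
  linarith

/-- **Threshold saturation for the GLDPC ensemble.** With `f(x;ε) = εx` and
`g(x) = Σ_{e=t}^{n−1} C(n−1,e) xᵉ (1−x)^{n−1−e}`, `2 ≤ t ≤ ⌊(n−1)/2⌋`: if
`ε < ε̄ = x̄/g(x̄)` (where `x̄` is the unique root of `P` in `(0,1]`) and
`w > K_{f,g}/ΔE(ε)`, then for every `L ≥ 1` the only fixed point of the basic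
spatially-coupled density-evolution recursion is the all-zero vector. -/
theorem gldpc_threshold_saturation (n t : ℕ) (ht1 : 2 ≤ t) (ht2 : t ≤ (n - 1) / 2)
    (xbar : ℝ) (hxbar : xbar ∈ Ioc (0:ℝ) 1) (hroot : gldpcP n t xbar = 0)
    (huniq : ∀ y ∈ Ioc (0:ℝ) 1, gldpcP n t y = 0 → y = xbar)
    (ε : ℝ) (hε : ε ∈ Icc (0:ℝ) 1) (hlt : ε < xbar / gldpcG n t xbar)
    (w L : ℕ) (hw : 1 ≤ w) (hL : 1 ≤ L)
    (hwK : Kfg (fun x ε' => ε' * x) (gldpcG n t) /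
      energyGap (fun x ε' => ε' * x) (gldpcG n t) ε < (w:ℝ))
    (x : ℤ → ℝ) (hmem : ∀ i : ℤ, x i ∈ Icc (0:ℝ) 1)
    (hfix : ∀ i : ℤ, x i = scUpdate (fun x' ε' => ε' * x') (gldpcG n t) ε L w x i) :
    ∀ i : ℤ, x i = 0 := by
  obtain ⟨s, rfl⟩ : ∃ s, t = s + 1 := ⟨t - 1, by omega⟩
  have hs : 1 ≤ s := by omega
  have hn : 2 * (s + 1) < n := by omega
  have h : s + 1 ≤ n - 1 := by omega
  have hg := monotoneOn_gldpcG h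
  have hg01 : ∀ x ∈ Icc (0:ℝ) 1, gldpcG n (s + 1) x ∈ Icc (0:ℝ) 1 :=
    fun x hx => gldpcG_mem_Icc h hx
  have hw0 : (0:ℝ) < w := by exact_mod_cast hw
  obtain ⟨z, hz, hmono, hsub, hz0, hzc, hxz⟩ :=
    exists_monotone_majorant hg hε.1 w hmem
      (fun i => (hfix i).le.trans (le_windowAverage_of_fixed hg01 hε.1 L w hmem i))
      (a := -L) (b := L + w)
      (fun i hi => by rw [hfix i, scUpdate, if_neg (by omega)])
      (fun i hi => by rw [hfix i, scUpdate, if_neg (by omega)])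
  set c := z (L + w) with hc
  rcases (hz (L + w)).1.eq_or_lt with hc0 | hc0
  · exact fun i => le_antisymm ((hxz i).trans hc0.symm.le) (hmem i).1
  exfalso
  have hcfix : c ≤ ε * gldpcG n (s + 1) c := by
    have hz' := hsub (L + w + w)
    rw [hzc _ (by omega)] at hz'
    have hA : windowAverage (gldpcG n (s + 1)) w z (L + w + w) = gldpcG n (s + 1) c := by
      unfold windowAverage
      rw [Finset.sum_congr rfl fun k hk => by
        rw [Finset.sum_congr rfl fun j _ => by
          rw [hzc _ (by have := Finset.mem_range.1 hk; omega)]]]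
      simp [hw0.ne', hc]
    rwa [hA] at hz'
  have hU := plateau_potential_le hg hg01 (mul_gldpcG_sub_integral_le h) hε.1 hw hz hmono hsub
    (a := -L) (b := L + w + 1) (by omega) hz0 (c := c) (fun i hi => hzc i (by omega))
  have hgap := energyGap_gldpc_le h (ε := ε) (c := c) ⟨uFix_le_of_le hc0 hcfix, (hz _).2⟩
  rw [singlePotential_gldpc h] at hgap
  have hpos := energyGap_gldpc_pos hs hn hxbar hroot huniq hε hlt
  have hK := one_le_Kfg_gldpc h
  rw [div_lt_iff₀ hpos] at hwK
  simp only [zero_mul, intervalIntegral.integral_same, sub_zero] at hU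
  have hε1 : ε * (1 / (2 * w)) ≤ 1 / (2 * w) := mul_le_of_le_one_left (by positivity) hε.2
  have hE : energyGap (fun x ε' => ε' * x) (gldpcG n (s + 1)) ε ≤ 1 / (2 * w) := by linarith
  have hwE := mul_le_mul_of_nonneg_left hE hw0.le
  have : (w:ℝ) * (1 / (2 * w)) = 1 / 2 := by field_simp
  linarith
end
end
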